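/- Let $l, m, n$ be positive integers with $l > m \geq n \geq l/2$ and let $c_1, c_2$ be rational constants. Then $\sum_{k=0}^{n} \binom{m+k}{k}\binom{m}{k}\binom{n+k}{k}\binom{n}{k} \Big\{ \big[1 + k(H_{m+k}^{(1)} + H_{m-k}^{(1)} + H_{n+k}^{(1)} + H_{n-k}^{(1)} - 4H_k^{(1)})\big]\big[c_1(H_{k+n}^{(1)} - H_{k+l-n-1}^{(1)}) + c_2(H_{k+m}^{(1)} - H_{k+l-m-1}^{(1)})\big] - k\big[c_1(H_{k+n}^{(2)} - H_{k+l-n-1}^{(2)}) + c_2(H_{k+m}^{(2)} - H_{k+l-m-1}^{(2)})\big] \Big\} + \sum_{k=n+1}^{m} (-1)^{k-n} \binom{m+k}{k}\binom{m}{k}\binom{n+k}{k}/\binom{k-1}{n} \cdot \big[c_1(H_{k+n}^{(1)} - H_{k+l-n-1}^{(1)}) + c_2(H_{k+m}^{(1)} - H_{k+l-m-1}^{(1)})\big] = 0$. -/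

import Mathlib

open Finset

/-- Generalized harmonicSum sum `H n^{(i)} = ∑_{j=1}^n 1/j^i`. -/
def harmonicSum (i n : ℕ) : ℚ := ∑ j ∈ Finset.range n, (1 : ℚ) / ((j : ℚ) + 1) ^ i

open Polynomial in
/-- Partial fraction decomposition in polynomial form: a polynomial is recovered from its
residues modulo pairwise coprime factors. -/
lemma eq_sum_mul_prod_erase {K ι : Type*} [Field K] [DecidableEq ι] (s : Finset ι)
    (P L : ι → K[X]) (N : K[X]) (hP : (s : Set ι).Pairwise fun i j => IsCoprime (P i) (P j))
    (hN : N.degree < (∏ i ∈ s, P i).degree) (hL : ∀ i ∈ s, (L i).degree < (P i).degree)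
    (hdvd : ∀ i ∈ s, P i ∣ N - L i * ∏ j ∈ s.erase i, P j) :
    N = ∑ i ∈ s, L i * ∏ j ∈ s.erase i, P j := by
  have hD : (∏ i ∈ s, P i) ∣ N - ∑ i ∈ s, L i * ∏ j ∈ s.erase i, P j := by
    refine Finset.prod_dvd_of_coprime hP fun i hi => ?_
    rw [← Finset.add_sum_erase _ _ hi, ← sub_sub]
    refine dvd_sub (hdvd i hi) (Finset.dvd_sum fun j hj => ?_)
    exact dvd_mul_of_dvd_right
      (Finset.dvd_prod_of_mem P (Finset.mem_erase.2 ⟨(Finset.ne_of_mem_erase hj).symm, hi⟩)) _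
  refine sub_eq_zero.1 (eq_zero_of_dvd_of_degree_lt hD ?_)
  have hP0 : ∏ i ∈ s, P i ≠ 0 := by
    rintro h
    simp [h] at hN
  have hbot : ⊥ < (∏ i ∈ s, P i).degree := bot_lt_iff_ne_bot.2 (by simpa using hP0)
  refine (degree_sub_le _ _).trans_lt (max_lt hN ?_)
  refine (degree_sum_le _ _).trans_lt ((Finset.sup_lt_iff hbot).2 fun i hi => ?_)
  rw [← Finset.mul_prod_erase s P hi, degree_mul, degree_mul]
  refine WithBot.add_lt_add_right ?_ (hL i hi)
  rw [Ne, degree_eq_bot]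
  intro h
  exact hP0 (by rw [← Finset.mul_prod_erase s P hi, h, mul_zero])

open Polynomial in
lemma eval_derivative_mul_of_eval_derivative {K : Type*} [Field K] {p q : K[X]} {x a b : K}
    (hp : p.derivative.eval x = p.eval x * a) (hq : q.derivative.eval x = q.eval x * b) :
    (p * q).derivative.eval x = (p * q).eval x * (a + b) := by
  rw [derivative_mul, eval_add, eval_mul, eval_mul, eval_mul, hp, hq]
  ring

open Polynomial in
lemma eval_derivative_prod_of_eval_derivative {K ι : Type*} [Field K] (s : Finset ι)
    (p : ι → K[X]) (x : K) (a : ι → K)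
    (h : ∀ i ∈ s, (p i).derivative.eval x = (p i).eval x * a i) :
    (∏ i ∈ s, p i).derivative.eval x = (∏ i ∈ s, p i).eval x * ∑ i ∈ s, a i := by
  classical
  induction s using Finset.induction_on with
  | empty => simp
  | insert i s hi ih =>
    rw [Finset.prod_insert hi, Finset.sum_insert hi]
    exact eval_derivative_mul_of_eval_derivative (h i (by simp))
      (ih fun j hj => h j (by simp [hj]))

open Polynomial in
lemma sq_X_sub_C_dvd_of_eval {K : Type*} [Field K] {p : K[X]} {x : K}
    (h0 : p.eval x = 0) (h1 : p.derivative.eval x = 0) : (X - C x) ^ 2 ∣ p := by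
  obtain ⟨q, rfl⟩ := dvd_iff_isRoot.2 h0
  have hq : q.eval x = 0 := by simpa using h1
  obtain ⟨r, rfl⟩ := dvd_iff_isRoot.2 hq
  exact ⟨r, by ring⟩

open Polynomial in
/-- The polynomial `∏ (X + i)` over `0 ≤ i ≤ n`, `i ≠ k`. -/
noncomputable def risingErase (n k : ℕ) : ℚ[X] :=
  ∏ i ∈ (range (n + 1)).erase k, (X - C (-(i : ℚ)))

open Polynomial in
/-- The polynomial `∏ (i - X)` over `1 ≤ i ≤ n`. -/
noncomputable def reflectedRising (n : ℕ) : ℚ[X] := ∏ i ∈ range n, (C ((i : ℚ) + 1) - X)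

lemma harmonicSum_succ (i n : ℕ) :
    harmonicSum i (n + 1) = harmonicSum i n + 1 / ((n : ℚ) + 1) ^ i :=
  Finset.sum_range_succ _ _

lemma harmonicSum_add_sub (i a d : ℕ) :
    harmonicSum i (a + d) - harmonicSum i a
      = ∑ j ∈ range d, 1 / ((a : ℚ) + (j : ℚ) + 1) ^ i := by
  induction d with
  | zero => simp
  | succ d ih =>
    rw [← add_assoc, harmonicSum_succ, Finset.sum_range_succ, ← ih]
    push_cast
    ring

lemma harmonicSum_sub_eq_sum_Icc (i k l p : ℕ) (hp : p < l) (hl : l ≤ 2 * p) :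
    harmonicSum i (k + p) - harmonicSum i (k + l - p - 1)
      = ∑ j ∈ Icc (l - p) p, 1 / ((k : ℚ) + (j : ℚ)) ^ i := by
  obtain ⟨q, rfl⟩ : ∃ q, l = p + 1 + q := ⟨l - (p + 1), by omega⟩
  obtain ⟨d, rfl⟩ : ∃ d, p = q + d := ⟨p - q, by omega⟩
  have h1 : k + (q + d + 1 + q) - (q + d) - 1 = k + q := by omega
  have h2 : q + d + 1 + q - (q + d) = q + 1 := by omega
  rw [h1, h2, ← add_assoc, harmonicSum_add_sub, ← Finset.Ico_add_one_right_eq_Icc,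
    Finset.sum_Ico_eq_sum_range]
  have h3 : q + d + 1 - (q + 1) = d := by omega
  rw [h3]
  refine Finset.sum_congr rfl fun j _ => ?_
  push_cast
  congr 2
  ring

lemma eval_reflectedRising (n k : ℕ) :
    (reflectedRising n).eval (-(k : ℚ)) = ((n + k).factorial : ℚ) / k.factorial := by
  induction n with
  | zero =>
    have : (k.factorial : ℚ) ≠ 0 := by positivity
    simp [reflectedRising, this]
  | succ n ih =>
    rw [reflectedRising, Finset.prod_range_succ, ← reflectedRising, Polynomial.eval_mul, ih,
      add_right_comm, Nat.factorial_succ]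
    simp
    ring

lemma eval_derivative_reflectedRising (n k : ℕ) :
    (reflectedRising n).derivative.eval (-(k : ℚ))
      = (reflectedRising n).eval (-(k : ℚ)) * -(harmonicSum 1 (n + k) - harmonicSum 1 k) := by
  rw [add_comm n k, harmonicSum_add_sub, ← Finset.sum_neg_distrib]
  refine eval_derivative_prod_of_eval_derivative _ _ _ _ fun i _ => ?_
  have : (k : ℚ) + i + 1 ≠ 0 := by positivity
  simp
  field_simp
  ring

lemma risingErase_succ (k n : ℕ) (h : n + 1 ≠ k) :
    risingErase (n + 1) k
      = (Polynomial.X - Polynomial.C (-((n + 1 : ℕ) : ℚ))) * risingErase n k := by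
  rw [risingErase, Finset.range_add_one, Finset.erase_insert_of_ne h, Finset.prod_insert (by simp),
    risingErase]

lemma eval_risingErase_self (k : ℕ) :
    (risingErase k k).eval (-(k : ℚ)) = (-1) ^ k * k.factorial := by
  rw [risingErase, Finset.range_add_one, Finset.erase_insert (by simp), ← Finset.prod_range_reflect,
    Polynomial.eval_prod, ← Finset.prod_range_add_one_eq_factorial, Nat.cast_prod]
  have : ((-1 : ℚ)) ^ k = ∏ _i ∈ range k, (-1 : ℚ) := by simp
  rw [this, ← Finset.prod_mul_distrib]
  refine Finset.prod_congr rfl fun i hi => ?_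
  have hi := Finset.mem_range.1 hi
  obtain ⟨d, rfl⟩ : ∃ d, k = i + 1 + d := ⟨k - (i + 1), by omega⟩
  have h1 : i + 1 + d - 1 - i = d := by omega
  rw [h1]
  simp

lemma eval_risingErase_of_le {n k : ℕ} (h : k ≤ n) :
    (risingErase n k).eval (-(k : ℚ)) = (-1) ^ k * k.factorial * (n - k).factorial := by
  induction n, h using Nat.le_induction with
  | base => simp [eval_risingErase_self]
  | succ n h ih =>
    rw [risingErase_succ k n (by omega), Polynomial.eval_mul, ih, Nat.succ_sub h,
      Nat.factorial_succ]
    push_cast [h]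
    simp
    ring

lemma eval_risingErase_of_lt {n k : ℕ} (h : n < k) :
    (risingErase n k).eval (-(k : ℚ)) * (k - 1 - n).factorial = (-1) ^ (n + 1) * k.factorial := by
  induction n with
  | zero =>
    obtain ⟨d, rfl⟩ : ∃ d, k = d + 1 := ⟨k - 1, by omega⟩
    simp [risingErase, Nat.factorial_succ]
    ring
  | succ n ih =>
    have ih := ih (by omega)
    obtain ⟨d, rfl⟩ : ∃ d, k = d + n + 2 := ⟨k - (n + 2), by omega⟩
    have h1 : d + n + 2 - 1 - n = d + 1 := by omega
    have h2 : d + n + 2 - 1 - (n + 1) = d := by omega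
    rw [h1, Nat.factorial_succ] at ih
    rw [risingErase_succ _ n (by omega), Polynomial.eval_mul, h2, pow_succ, mul_assoc _ (-1 : ℚ),
      mul_comm (-1 : ℚ), ← mul_assoc, ← ih]
    push_cast
    simp
    ring

lemma sum_inv_sub {n k : ℕ} (h : k ≤ n) :
    ∑ i ∈ (range (n + 1)).erase k, ((i : ℚ) - k)⁻¹
      = harmonicSum 1 (n - k) - harmonicSum 1 k := by
  rw [Finset.sum_erase _ (by simp)]
  induction n, h using Nat.le_induction with
  | base =>
    rw [Finset.sum_range_succ, ← Finset.sum_range_reflect]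
    rw [sub_self, inv_zero, add_zero, Nat.sub_self, harmonicSum, harmonicSum, Finset.sum_range_zero,
      zero_sub, ← Finset.sum_neg_distrib]
    refine Finset.sum_congr rfl fun i hi => ?_
    have hi := Finset.mem_range.1 hi
    obtain ⟨d, rfl⟩ : ∃ d, k = i + 1 + d := ⟨k - (i + 1), by omega⟩
    have h1 : i + 1 + d - 1 - i = d := by omega
    rw [h1, pow_one, one_div, ← inv_neg]
    push_cast
    ring
  | succ n h ih =>
    rw [Finset.sum_range_succ, ih, Nat.succ_sub h, harmonicSum_succ]
    push_cast [h]
    ring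

lemma eval_derivative_risingErase {n k : ℕ} (h : k ≤ n) :
    (risingErase n k).derivative.eval (-(k : ℚ))
      = (risingErase n k).eval (-(k : ℚ)) * (harmonicSum 1 (n - k) - harmonicSum 1 k) := by
  rw [← sum_inv_sub h]
  refine eval_derivative_prod_of_eval_derivative _ _ _ _ fun i hi => ?_
  have : (i : ℚ) - k ≠ 0 := sub_ne_zero.2 (by exact_mod_cast Finset.ne_of_mem_erase hi)
  simp
  rw [neg_add_eq_sub, mul_inv_cancel₀ this]

open Polynomial in
/-- The factor `(X + k) ^ 2` for `k ≤ n` and `X + k` for `k > n`. -/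
noncomputable def poleFactor (n k : ℕ) : ℚ[X] :=
  (X - C (-(k : ℚ))) ^ (if k ≤ n then 2 else 1)

lemma prod_erase_poleFactor {m n : ℕ} (h : n ≤ m) (k : ℕ) :
    ∏ i ∈ (range (m + 1)).erase k, poleFactor n i = risingErase m k * risingErase n k := by
  have hs : (range (n + 1)).erase k = ((range (m + 1)).erase k).filter (· ≤ n) := by
    ext i
    simp only [mem_erase, mem_range, mem_filter]
    omega
  rw [risingErase, risingErase, hs, Finset.prod_filter, ← Finset.prod_mul_distrib]
  refine Finset.prod_congr rfl fun i _ => ?_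
  rw [poleFactor]
  split_ifs <;> ring

/-- The coefficient common to the two terms with a double pole at `-k`. -/
def doubleCoeff (m n k : ℕ) : ℚ :=
  ((m + k).choose k : ℚ) * (m.choose k : ℚ) * ((n + k).choose k : ℚ) * (n.choose k : ℚ)

/-- The coefficient of a simple pole at `-k`. -/
def simpleCoeff (m n k : ℕ) : ℚ :=
  (-1 : ℚ) ^ (k - n) * ((m + k).choose k : ℚ) * (m.choose k : ℚ) * ((n + k).choose k : ℚ)
    / ((k - 1).choose n : ℚ)

/-- The harmonic factor in the residue at a double pole `-k`. -/
def residueFactor (m n k : ℕ) : ℚ :=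
  1 + (k : ℚ) * (harmonicSum 1 (m + k) + harmonicSum 1 (m - k) + harmonicSum 1 (n + k)
    + harmonicSum 1 (n - k) - 4 * harmonicSum 1 k)

lemma cast_choose_mul_choose {n k : ℕ} (h : k ≤ n) :
    ((n + k).choose k : ℚ) * (n.choose k : ℚ)
      = (n + k).factorial / ((k.factorial : ℚ) ^ 2 * (n - k).factorial) := by
  rw [Nat.cast_choose ℚ h, Nat.cast_choose ℚ (Nat.le_add_left k n), Nat.add_sub_cancel]
  field_simp

lemma doubleCoeff_mul_eval {m n k : ℕ} (hnm : n ≤ m) (h : k ≤ n) :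
    doubleCoeff m n k * (risingErase m k * risingErase n k).eval (-(k : ℚ))
      = (reflectedRising m * reflectedRising n).eval (-(k : ℚ)) := by
  rw [Polynomial.eval_mul, Polynomial.eval_mul, eval_risingErase_of_le h,
    eval_risingErase_of_le (h.trans hnm), eval_reflectedRising, eval_reflectedRising, doubleCoeff,
    cast_choose_mul_choose (h.trans hnm), mul_assoc (_ / _), cast_choose_mul_choose h]
  have : ((-1 : ℚ) ^ k) * (-1) ^ k = 1 := by rw [← mul_pow]; simp
  field_simp
  linear_combination this

lemma simpleCoeff_mul_eval {m n k : ℕ} (hk : n < k) (h : k ≤ m) :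
    simpleCoeff m n k * (risingErase m k * risingErase n k).eval (-(k : ℚ))
      = -(k : ℚ) * (reflectedRising m * reflectedRising n).eval (-(k : ℚ)) := by
  have hlt := eval_risingErase_of_lt hk
  have hf : ((k - 1 - n).factorial : ℚ) ≠ 0 := by positivity
  rw [← eq_div_iff hf] at hlt
  rw [Polynomial.eval_mul, Polynomial.eval_mul, hlt,
    eval_risingErase_of_le h, eval_reflectedRising, eval_reflectedRising, simpleCoeff,
    mul_assoc _ (Nat.cast _) (Nat.cast (m.choose k)),
    cast_choose_mul_choose h, Nat.cast_choose ℚ (Nat.le_add_left k n), Nat.add_sub_cancel,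
    Nat.cast_choose ℚ (Nat.le_sub_one_of_lt hk)]
  obtain ⟨d, rfl⟩ : ∃ d, k = n + 1 + d := ⟨k - (n + 1), by omega⟩
  have h1 : n + 1 + d - 1 = n + d := by omega
  have h2 : n + 1 + d - n = d + 1 := by omega
  have h3 : n + 1 + d = n + d + 1 := by omega
  have h4 : ((n + 1 + d).factorial : ℚ) = ((n + 1 + d : ℕ) : ℚ) * (n + d).factorial := by
    rw [h3, Nat.factorial_succ]
    push_cast
    ring
  have hs : ((-1 : ℚ) ^ (d + 1)) * (-1) ^ (n + 1 + d) * (-1) ^ (n + 1) = -1 := by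
    rw [← pow_add, ← pow_add]
    exact Odd.neg_one_pow ⟨d + n + 1, by ring⟩
  rw [h1, h2]
  have hf2 : ((n + 1 + d).factorial : ℚ) ≠ 0 := by positivity
  field_simp
  rw [h4]
  linear_combination ((n + 1 + d : ℕ) : ℚ) * (n + d).factorial * hs

lemma degree_risingErase_zero (n : ℕ) : (risingErase n 0).degree = n := by
  rw [risingErase, Polynomial.degree_prod]
  simp only [Polynomial.degree_X_sub_C]
  simp

lemma degree_reflectedRising (n : ℕ) : (reflectedRising n).degree = n := by
  have h (a : ℚ) : (Polynomial.C a - Polynomial.X).degree = 1 := by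
    rw [← neg_sub, Polynomial.degree_neg, Polynomial.degree_X_sub_C]
  rw [reflectedRising, Polynomial.degree_prod]
  simp only [h]
  simp

lemma eval_reflectedRising_eq_zero {n j : ℕ} (hj : 1 ≤ j) (h : j ≤ n) :
    (reflectedRising n).eval (j : ℚ) = 0 := by
  rw [reflectedRising, Polynomial.eval_prod]
  refine Finset.prod_eq_zero (i := j - 1) (Finset.mem_range.2 (by omega)) ?_
  push_cast [hj]
  simp

open Polynomial in
/-- The numerator of the partial fraction with pole at `-k`. -/
noncomputable def poleNumerator (m n k : ℕ) : ℚ[X] :=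
  if k ≤ n then C (doubleCoeff m n k * -k)
    + C (doubleCoeff m n k * residueFactor m n k) * (X - C (-(k : ℚ)))
  else C (simpleCoeff m n k)

open Polynomial in
lemma degree_poleNumerator_lt (m n k : ℕ) :
    (poleNumerator m n k).degree < (poleFactor n k).degree := by
  rw [poleNumerator, poleFactor, degree_pow, degree_X_sub_C]
  split_ifs with h
  · refine (degree_add_le _ _).trans_lt (max_lt (degree_C_le.trans_lt (by simp)) ?_)
    rw [degree_mul, degree_X_sub_C]
    exact (add_le_add_left degree_C_le 1).trans_lt (by norm_num)
  · exact degree_C_le.trans_lt (by simp)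

open Polynomial in
lemma poleFactor_dvd {m n k : ℕ} (hnm : n ≤ m) (hk : k ≤ m) :
    poleFactor n k ∣ X * (reflectedRising m * reflectedRising n)
      - poleNumerator m n k * (risingErase m k * risingErase n k) := by
  rw [poleFactor, poleNumerator]
  split_ifs with h
  · have hc := doubleCoeff_mul_eval hnm h
    have hN := eval_derivative_mul_of_eval_derivative (eval_derivative_reflectedRising m k)
      (eval_derivative_reflectedRising n k)
    have hE := eval_derivative_mul_of_eval_derivative (eval_derivative_risingErase hk)
      (eval_derivative_risingErase h)
    generalize reflectedRising m * reflectedRising n = N at *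
    generalize risingErase m k * risingErase n k = E at *
    refine sq_X_sub_C_dvd_of_eval ?_ ?_
    · simp
      linear_combination (k : ℚ) * hc
    · rw [derivative_sub, derivative_mul, derivative_mul, eval_sub, eval_add, eval_add, eval_mul,
        eval_mul, eval_mul, eval_mul, hN, hE, ← hc]
      simp [residueFactor]
      ring
  · rw [pow_one, dvd_iff_isRoot, IsRoot, eval_sub, eval_mul, eval_X, eval_mul (p := C _), eval_C,
      simpleCoeff_mul_eval (not_le.1 h) hk, sub_self]

open Polynomial in
lemma sum_poleNumerator_mul {m n : ℕ} (hnm : n ≤ m) :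
    X * (reflectedRising m * reflectedRising n)
      = ∑ k ∈ range (m + 1), poleNumerator m n k * ∏ i ∈ (range (m + 1)).erase k,
          poleFactor n i := by
  refine eq_sum_mul_prod_erase _ _ _ _ (fun i _ j _ hij => ?_) ?_
    (fun k _ => degree_poleNumerator_lt m n k) fun k hk => ?_
  · refine IsCoprime.pow (pairwise_coprime_X_sub_C (s := fun i : ℕ => -(i : ℚ)) ?_ hij)
    exact neg_injective.comp Nat.cast_injective
  · rw [← Finset.mul_prod_erase _ _ (Finset.mem_range.2 m.succ_pos), prod_erase_poleFactor hnm,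
      poleFactor, if_pos n.zero_le]
    simp only [degree_mul, degree_pow, degree_X_sub_C, degree_risingErase_zero,
      degree_reflectedRising, degree_X]
    norm_cast
    simp only [nsmul_eq_mul]
    norm_cast
    omega
  · rw [prod_erase_poleFactor hnm]
    exact poleFactor_dvd hnm (Nat.lt_succ_iff.1 (Finset.mem_range.1 hk))

lemma sum_partialFractions_eq_zero {m n j : ℕ} (hnm : n ≤ m) (hj : 1 ≤ j) (hjm : j ≤ m) :
    ∑ k ∈ range (n + 1), doubleCoeff m n k * (residueFactor m n k * (1 / ((k : ℚ) + j) ^ 1)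
        - k * (1 / ((k : ℚ) + j) ^ 2))
      + ∑ k ∈ Icc (n + 1) m, simpleCoeff m n k * (1 / ((k : ℚ) + j) ^ 1) = 0 := by
  have h := congrArg (Polynomial.eval (j : ℚ)) (sum_poleNumerator_mul hnm)
  have hP (k : ℕ) : (poleFactor n k).eval (j : ℚ) ≠ 0 := by
    have : (j : ℚ) + k ≠ 0 := by positivity
    rw [poleFactor, Polynomial.eval_pow]
    exact pow_ne_zero _ (by simpa using this)
  have hD : (∏ k ∈ range (m + 1), poleFactor n k).eval (j : ℚ) ≠ 0 := by
    rw [Polynomial.eval_prod]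
    exact Finset.prod_ne_zero_iff.2 fun k _ => hP k
  have hterm : ∀ k ∈ range (m + 1),
      (poleNumerator m n k * ∏ i ∈ (range (m + 1)).erase k, poleFactor n i).eval (j : ℚ)
        = (∏ k ∈ range (m + 1), poleFactor n k).eval (j : ℚ)
          * ((poleNumerator m n k).eval (j : ℚ) / (poleFactor n k).eval (j : ℚ)) := by
    intro k hk
    rw [← Finset.mul_prod_erase _ _ hk, Polynomial.eval_mul, Polynomial.eval_mul]
    field_simp [hP k]
  rw [Polynomial.eval_mul, Polynomial.eval_mul, eval_reflectedRising_eq_zero hj hjm, zero_mul,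
    mul_zero, Polynomial.eval_finsetSum, Finset.sum_congr rfl hterm, ← Finset.mul_sum] at h
  have h := (mul_eq_zero.1 h.symm).resolve_left hD
  rw [← h, Finset.range_eq_Ico, Finset.range_eq_Ico, ← Finset.Ico_add_one_right_eq_Icc,
    ← Finset.sum_Ico_consecutive _ (n + 1).zero_le (Nat.succ_le_succ hnm)]
  congr 1
  · refine Finset.sum_congr rfl fun k hk => ?_
    have hk : k ≤ n := Nat.lt_succ_iff.1 (Finset.mem_Ico.1 hk).2
    have : (k : ℚ) + j ≠ 0 := by positivity
    have h' : (j : ℚ) + k ≠ 0 := by positivity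
    simp [poleNumerator, poleFactor, hk]
    field_simp
    ring
  · refine Finset.sum_congr rfl fun k hk => ?_
    have hk : ¬k ≤ n := not_le.2 (Finset.mem_Ico.1 hk).1
    simp [poleNumerator, poleFactor, hk, div_eq_mul_inv, add_comm]

lemma sum_harmonicSum_sub_eq_zero {l m n p : ℕ} (hnm : n ≤ m) (hpl : p < l) (hlp : l ≤ 2 * p)
    (hpm : p ≤ m) :
    ∑ k ∈ range (n + 1), doubleCoeff m n k
        * (residueFactor m n k * (harmonicSum 1 (k + p) - harmonicSum 1 (k + l - p - 1))
          - k * (harmonicSum 2 (k + p) - harmonicSum 2 (k + l - p - 1)))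
      + ∑ k ∈ Icc (n + 1) m, simpleCoeff m n k
          * (harmonicSum 1 (k + p) - harmonicSum 1 (k + l - p - 1)) = 0 := by
  simp only [harmonicSum_sub_eq_sum_Icc _ _ l p hpl hlp, Finset.mul_sum,
    ← Finset.sum_sub_distrib]
  rw [Finset.sum_comm, Finset.sum_comm (s := Icc (n + 1) m), ← Finset.sum_add_distrib]
  refine Finset.sum_eq_zero fun j hj => ?_
  have hj := Finset.mem_Icc.1 hj
  exact sum_partialFractions_eq_zero hnm (by omega) (hj.2.trans hpm)

theorem stmt_2 (l m n : ℕ) (hl : 0 < l) (hn : 0 < n) (hlm : m < l) (hnm : n ≤ m)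
    (hln : l ≤ 2 * n) (c₁ c₂ : ℚ) :
    (∑ k ∈ Finset.range (n + 1),
      ((m + k).choose k : ℚ) * (m.choose k : ℚ) * ((n + k).choose k : ℚ) * (n.choose k : ℚ) *
        ((1 + (k : ℚ) * (harmonicSum 1 (m + k) + harmonicSum 1 (m - k) + harmonicSum 1 (n + k)
            + harmonicSum 1 (n - k) - 4 * harmonicSum 1 k))
          * (c₁ * (harmonicSum 1 (k + n) - harmonicSum 1 (k + l - n - 1))
            + c₂ * (harmonicSum 1 (k + m) - harmonicSum 1 (k + l - m - 1)))
        - (k : ℚ) * (c₁ * (harmonicSum 2 (k + n) - harmonicSum 2 (k + l - n - 1))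
            + c₂ * (harmonicSum 2 (k + m) - harmonicSum 2 (k + l - m - 1)))))
    + (∑ k ∈ Finset.Icc (n + 1) m,
      (-1 : ℚ) ^ (k - n) * ((m + k).choose k : ℚ) * (m.choose k : ℚ) * ((n + k).choose k : ℚ)
        / ((k - 1).choose n : ℚ)
        * (c₁ * (harmonicSum 1 (k + n) - harmonicSum 1 (k + l - n - 1))
          + c₂ * (harmonicSum 1 (k + m) - harmonicSum 1 (k + l - m - 1))))
    = 0 := by
  have h₁ := sum_harmonicSum_sub_eq_zero hnm (hnm.trans_lt hlm) hln hnm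
  have h₂ := sum_harmonicSum_sub_eq_zero hnm hlm (hln.trans (by omega)) le_rfl
  have h := congrArg₂ (fun x y => c₁ * x + c₂ * y) h₁ h₂
  simp only [mul_zero, add_zero, mul_add, Finset.mul_sum] at h
  rw [add_add_add_comm, ← Finset.sum_add_distrib, ← Finset.sum_add_distrib] at h
  rw [← h]
  congr 1 <;> refine Finset.sum_congr rfl fun k _ => ?_
  · simp only [doubleCoeff, residueFactor]
    ring
  · simp only [simpleCoeff]
    ring
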